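/- Let K be an infinite field, let m ≥ 1, let X ⊆ K^m be a non-empty subset, and let A = K[x_1,...,x_m]/I(X) be its coordinate ring, where I(X) denotes the vanishing ideal of X in the polynomial ring K[x_1,...,x_m]. Then every finitely generated K-subalgebra B of A is a coordinate ring of some K-algebraic set: there exist n ≥ 1 and a subset S ⊆ K^n such that B is isomorphic as a K-algebra to K[y_1,...,y_n]/I(S). -/

import Mathlib

/-- Over an infinite field `K`, every finitely generated `K`-subalgebra of the
coordinate ring `K[x_1,…,x_m]/I(X)` of a non-empty subset `X ⊆ K^m` is itself (isomorphic to)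
a coordinate ring `K[y_1,…,y_n]/I(S)` of some subset `S ⊆ K^n`. -/
theorem pushouts_stmt0 (K : Type*) [Field K] [Infinite K] (m : ℕ) (hm : 1 ≤ m)
    (X : Set (Fin m → K)) (hX : X.Nonempty)
    (B : Subalgebra K (MvPolynomial (Fin m) K ⧸ MvPolynomial.vanishingIdeal K X))
    (hB : B.FG) :
    ∃ n : ℕ, 1 ≤ n ∧ ∃ S : Set (Fin n → K),
      Nonempty (B ≃ₐ[K] (MvPolynomial (Fin n) K ⧸ MvPolynomial.vanishingIdeal K S)) := by
  classical
  obtain ⟨t, ht⟩ := hB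
  let b : Fin (t.card + 1) → (MvPolynomial (Fin m) K ⧸ MvPolynomial.vanishingIdeal K X) :=
    Fin.cons 0 (fun i => (t.equivFin.symm i : _))
  have hb : Algebra.adjoin K (Set.range b) = B := by
    rw [← ht]
    apply le_antisymm
    · rw [Algebra.adjoin_le_iff]
      rintro _ ⟨i, rfl⟩
      refine Fin.cases ?_ (fun j => ?_) i
      · exact Subalgebra.zero_mem _
      · exact Algebra.subset_adjoin (t.equivFin.symm j).2
    · apply Algebra.adjoin_mono
      intro a ha
      exact ⟨Fin.succ (t.equivFin ⟨a, ha⟩), by simp [b]⟩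
  choose p hp using fun i => Ideal.Quotient.mk_surjective (b i)
  let φ : MvPolynomial (Fin (t.card + 1)) K →ₐ[K]
    (MvPolynomial (Fin m) K ⧸ MvPolynomial.vanishingIdeal K X) := MvPolynomial.aeval b
  have hr : φ.range = B := by
    rw [← hb, Algebra.adjoin_range_eq_range_aeval]
  have hφ : ∀ q, φ q = Ideal.Quotient.mk _ (MvPolynomial.aeval p q) := by
    intro q
    have : φ = (Ideal.Quotient.mkₐ K (MvPolynomial.vanishingIdeal K X)).comp
        (MvPolynomial.aeval p) := by
      apply MvPolynomial.algHom_ext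
      intro i
      simp [φ, hp]
    rw [this]
    rfl
  refine ⟨t.card + 1, by omega,
    (fun (x : Fin m → K) i => MvPolynomial.aeval x (p i)) '' X, ⟨?_⟩⟩
  have hk : RingHom.ker φ = MvPolynomial.vanishingIdeal K
      ((fun (x : Fin m → K) i => MvPolynomial.aeval x (p i)) '' X) := by
    ext q
    rw [RingHom.mem_ker, hφ, Ideal.Quotient.eq_zero_iff_mem,
      MvPolynomial.mem_vanishingIdeal_iff, MvPolynomial.mem_vanishingIdeal_iff,
      Set.forall_mem_image]
    refine forall₂_congr fun x _ => ?_
    have : (MvPolynomial.aeval x : MvPolynomial (Fin m) K →ₐ[K] K).comp (MvPolynomial.aeval p)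
        = MvPolynomial.aeval (fun i => MvPolynomial.aeval x (p i)) := by
      apply MvPolynomial.algHom_ext
      intro i
      simp
    rw [← this]
    rfl
  exact (Subalgebra.equivOfEq _ _ hr.symm).trans
    ((Ideal.quotientKerEquivRange φ).symm.trans (Ideal.quotientEquivAlgOfEq K hk))
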